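/- arXiv:1409.5685 — 2 statements merged into one kernel-verified Lean document; each statement's English description precedes it below -/
import Mathlib

section
/- Let m ≥ 3 be an integer. If k is a positive integer with k·m − p_k = S(m), then k > e^{m−1}/(m − 1)^2. -/
/-- The k-th prime, 1-indexed: `nthPrime 1 = 2`. -/
noncomputable def nthPrime (k : ℕ) : ℕ := Nat.nth Nat.Prime (k - 1)

/-- `IsS m S` says that `S` is the maximum of `{k*m - p_k : k ≥ 1}`. -/
def IsS (m : ℕ) (S : ℤ) : Prop :=
  IsGreatest {a : ℤ | ∃ k : ℕ, 0 < k ∧ a = (k : ℤ) * m - nthPrime k} S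


section Helpers
open Finset


/-- The kernel polynomial. -/
noncomputable def kerA (w : ℝ) : ℝ := (1 - w) ^ 2 * (4 * w - 1)

/-- The summatory kernel. -/
noncomputable def kerG (y : ℝ) : ℝ := ∑ j ∈ Icc 1 ⌊y⌋₊, kerA (j / y)

/-- Closed form of the partial sums of `kerA (j / y)`. -/
noncomputable def kerF (n y : ℝ) : ℝ :=
  -n + 3 * n * (n + 1) / y - 3 / 2 * (n * (n + 1) * (2 * n + 1)) / y ^ 2
    + n ^ 2 * (n + 1) ^ 2 / y ^ 3

lemma sum_kerA (n : ℕ) (y : ℝ) (hy : y ≠ 0) :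
    ∑ j ∈ Icc 1 n, kerA (j / y) = kerF n y := by
  induction n with
  | zero => simp [kerF]
  | succ n ih =>
    rw [sum_Icc_succ_top (by omega), ih]
    unfold kerF kerA
    push_cast
    field_simp
    ring

lemma kerF_left (n : ℝ) (hn : 0 < n) : kerF n n = 1 / 2 - 1 / (2 * n) := by
  unfold kerF; field_simp; ring

lemma kerF_right (n : ℝ) (hn : 0 < n) : kerF n (n + 1) = 1 / 2 - 1 / (2 * (n + 1)) := by
  unfold kerF; field_simp; ring

lemma kerF_hasDeriv (n y : ℝ) (hy : 0 < y) :
    HasDerivAt (kerF n) (3 * n * (n + 1) * (y - n) * (n + 1 - y) / y ^ 4) y := by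
  have h1 := (hasDerivAt_id y).inv hy.ne'
  have e : kerF n = fun y => -n + (3 * n * (n + 1)) * y⁻¹
      - (3 / 2 * (n * (n + 1) * (2 * n + 1))) * (y⁻¹) ^ 2
      + (n ^ 2 * (n + 1) ^ 2) * (y⁻¹) ^ 3 := by
    ext z; unfold kerF; simp only [div_eq_mul_inv, inv_pow]
  rw [e]
  have h2 := (((h1.const_mul (3 * n * (n + 1))).const_add (-n)).sub
    ((h1.pow 2).const_mul (3 / 2 * (n * (n + 1) * (2 * n + 1))))).add
    ((h1.pow 3).const_mul (n ^ 2 * (n + 1) ^ 2))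
  convert! h2 using 1
  simp only [id, Pi.inv_apply]
  field_simp
  norm_num
  field_simp
  ring

lemma kerF_mono (n : ℕ) (hn : 1 ≤ n) : MonotoneOn (kerF n) (Set.Icc (n : ℝ) (n + 1)) := by
  have hn' : (1 : ℝ) ≤ n := by exact_mod_cast hn
  apply monotoneOn_of_deriv_nonneg (convex_Icc _ _)
  · intro y hy
    exact (kerF_hasDeriv n y (by linarith [hy.1])).continuousAt.continuousWithinAt
  · intro y hy
    rw [interior_Icc] at hy
    exact (kerF_hasDeriv n y (by linarith [hy.1])).differentiableAt.differentiableWithinAt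
  · intro y hy
    rw [interior_Icc] at hy
    rw [(kerF_hasDeriv n y (by linarith [hy.1])).deriv]
    have := hy.1; have := hy.2
    have h1 : 0 ≤ y - n := by linarith
    have h2 : 0 ≤ n + 1 - y := by linarith
    positivity

lemma kerG_eq (y : ℝ) (hy : 0 < y) : kerG y = kerF ⌊y⌋₊ y := sum_kerA _ _ hy.ne'

lemma kerG_zero {y : ℝ} (hy : y < 1) : kerG y = 0 := by
  unfold kerG
  rw [Nat.floor_eq_zero.2 hy]; simp

lemma kerG_bounds (y : ℝ) (hy : 1 ≤ y) :
    1 / 2 - 1 / (2 * (⌊y⌋₊ : ℝ)) ≤ kerG y ∧ kerG y ≤ 1 / 2 - 1 / (2 * ((⌊y⌋₊ : ℝ) + 1)) := by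
  have h1 : 1 ≤ ⌊y⌋₊ := (Nat.one_le_floor_iff y).2 hy
  have h1' : (1 : ℝ) ≤ ⌊y⌋₊ := by exact_mod_cast h1
  have h2 : (⌊y⌋₊ : ℝ) ≤ y := Nat.floor_le (by linarith)
  have h3 : y < ⌊y⌋₊ + 1 := Nat.lt_floor_add_one y
  rw [kerG_eq y (by linarith), ← kerF_left _ (by linarith), ← kerF_right _ (by linarith)]
  constructor
  · exact kerF_mono _ h1 ⟨le_rfl, by linarith⟩ ⟨h2, h3.le⟩ h2
  · exact kerF_mono _ h1 ⟨h2, h3.le⟩ ⟨by linarith, le_rfl⟩ h3.le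

lemma kerG_nonneg (y : ℝ) : 0 ≤ kerG y := by
  rcases lt_or_ge y 1 with h | h
  · rw [kerG_zero h]
  · refine le_trans ?_ (kerG_bounds y h).1
    have h1 : 1 ≤ ⌊y⌋₊ := (Nat.one_le_floor_iff y).2 h
    have h1' : (1 : ℝ) ≤ ⌊y⌋₊ := by exact_mod_cast h1
    rw [sub_nonneg]
    apply one_div_le_one_div_of_le <;> linarith

lemma kerG_le_half (y : ℝ) : kerG y ≤ 1 / 2 := by
  rcases lt_or_ge y 1 with h | h
  · rw [kerG_zero h]; norm_num
  · refine le_trans (kerG_bounds y h).2 ?_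
    have : (0 : ℝ) ≤ 1 / (2 * ((⌊y⌋₊ : ℝ) + 1)) := by positivity
    linarith

lemma kerG_mono : Monotone kerG := by
  intro y z hyz
  rcases lt_or_ge y 1 with h | h
  · rw [kerG_zero h]; exact kerG_nonneg z
  have hz : 1 ≤ z := h.trans hyz
  have hf := Nat.floor_mono hyz
  have h1 : 1 ≤ ⌊y⌋₊ := (Nat.one_le_floor_iff y).2 h
  have h1' : (1 : ℝ) ≤ ⌊y⌋₊ := by exact_mod_cast h1
  have h2 : (⌊y⌋₊ : ℝ) ≤ y := Nat.floor_le (by linarith)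
  have h3 : y < ⌊y⌋₊ + 1 := Nat.lt_floor_add_one y
  rcases hf.eq_or_lt with e | l
  · have h4 : z < ⌊z⌋₊ + 1 := Nat.lt_floor_add_one z
    rw [kerG_eq y (by linarith), kerG_eq z (by linarith), ← e]
    rw [← e] at h4
    exact kerF_mono _ h1 ⟨h2, h3.le⟩ ⟨by linarith, h4.le⟩ hyz
  · refine (kerG_bounds y h).2.trans (le_trans ?_ (kerG_bounds z hz).1)
    have : (⌊y⌋₊ : ℝ) + 1 ≤ ⌊z⌋₊ := by exact_mod_cast l
    gcongr

lemma hasDeriv_max_cube (v : ℝ) :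
    HasDerivAt (fun v : ℝ => (max 0 v) ^ 3) (3 * (max 0 v) ^ 2) v := by
  rcases lt_trichotomy v 0 with h | h | h
  · rw [max_eq_left h.le]
    have : (fun v : ℝ => (max 0 v) ^ 3) =ᶠ[nhds v] fun _ => 0 := by
      filter_upwards [Iio_mem_nhds h] with z hz
      rw [max_eq_left (le_of_lt hz)]; norm_num
    simpa using (hasDerivAt_const v (0 : ℝ)).congr_of_eventuallyEq this
  · subst h
    simp only [max_self]
    rw [hasDerivAt_iff_isLittleO_nhds_zero]
    simp only [zero_add, max_self]
    have h1 : (fun h : ℝ => (max 0 h) ^ 3) =O[nhds 0] fun h : ℝ => h ^ 3 := by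
      apply Asymptotics.IsBigO.of_bound 1
      filter_upwards with z
      simp only [norm_pow, one_mul]
      gcongr
      rw [Real.norm_eq_abs, Real.norm_eq_abs, abs_of_nonneg (le_max_left _ _)]
      exact max_le (abs_nonneg _) (le_abs_self _)
    have h2 : (fun h : ℝ => h ^ 3) =o[nhds 0] fun h : ℝ => h := by
      simpa using Asymptotics.isLittleO_pow_pow (𝕜 := ℝ) (show 1 < 3 by norm_num)
    simpa using h1.trans_isLittleO h2
  · rw [max_eq_right h.le]
    have : (fun v : ℝ => (max 0 v) ^ 3) =ᶠ[nhds v] fun v => v ^ 3 := by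
      filter_upwards [Ioi_mem_nhds h] with z hz
      rw [max_eq_right (le_of_lt hz)]
    simpa using (hasDerivAt_pow 3 v).congr_of_eventuallyEq this

/-- Antiderivative of `u ↦ kerG (X / u)`. -/
noncomputable def kerR (X : ℕ) (u : ℝ) : ℝ :=
  -∑ j ∈ Icc 1 X, u * (max 0 (1 - j * u / X)) ^ 3

lemma kerR_deriv (X : ℕ) (u : ℝ) (hX : 1 ≤ X) (hu : 1 ≤ u) :
    HasDerivAt (kerR X) (kerG (X / u)) u := by
  have hX' : (1 : ℝ) ≤ X := by exact_mod_cast hX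
  have key : ∀ j ∈ Icc 1 X, HasDerivAt (fun u : ℝ => u * (max 0 (1 - (j : ℝ) * u / X)) ^ 3)
      (1 * (max 0 (1 - (j : ℝ) * u / X)) ^ 3
        + u * (3 * (max 0 (1 - (j : ℝ) * u / X)) ^ 2 * (-((j : ℝ) * 1 / X)))) u := by
    intro j _
    have h1 : HasDerivAt (fun u : ℝ => 1 - (j : ℝ) * u / X) (-((j : ℝ) * 1 / X)) u :=
      (((hasDerivAt_id u).const_mul (j : ℝ)).div_const (X : ℝ)).const_sub 1
    have h2 : HasDerivAt (fun u : ℝ => (max 0 (1 - (j : ℝ) * u / X)) ^ 3)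
        (3 * (max 0 (1 - (j : ℝ) * u / X)) ^ 2 * (-((j : ℝ) * 1 / X))) u :=
      HasDerivAt.comp (h₂ := fun v : ℝ => (max 0 v) ^ 3) (h := fun u : ℝ => 1 - (j : ℝ) * u / X) u
        (hasDeriv_max_cube (1 - (j : ℝ) * u / X)) h1
    exact (hasDerivAt_id u).mul h2
  have h := (HasDerivAt.fun_sum key).neg
  have e : kerG (X / u) = -∑ j ∈ Icc 1 X, (1 * (max 0 (1 - (j : ℝ) * u / X)) ^ 3
        + u * (3 * (max 0 (1 - (j : ℝ) * u / X)) ^ 2 * (-((j : ℝ) * 1 / X)))) := by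
    rw [← sum_neg_distrib]
    unfold kerG
    have hsub : Icc 1 ⌊(X : ℝ) / u⌋₊ ⊆ Icc 1 X := by
      apply Icc_subset_Icc_right
      apply Nat.floor_le_of_le
      rw [div_le_iff₀ (by linarith)]
      nlinarith
    rw [← sum_subset hsub]
    · apply sum_congr rfl
      intro j hj
      rw [mem_Icc] at hj
      have h1 : (j : ℝ) ≤ X / u := (Nat.le_floor_iff (by positivity)).1 hj.2
      rw [le_div_iff₀ (by linarith)] at h1
      have h2 : 0 ≤ 1 - (j : ℝ) * u / X := by
        rw [sub_nonneg, div_le_one (by linarith)]; exact h1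
      rw [max_eq_right h2]
      unfold kerA
      field_simp
      ring
    · intro j hj hj2
      rw [mem_Icc] at hj hj2
      have h1 : ⌊(X : ℝ) / u⌋₊ < j := by
        by_contra hc; exact hj2 ⟨hj.1, by omega⟩
      rw [Nat.floor_lt (by positivity), div_lt_iff₀ (by linarith)] at h1
      have h2 : 1 - (j : ℝ) * u / X ≤ 0 := by
        rw [sub_nonpos, one_le_div (by linarith)]; exact h1.le
      rw [max_eq_left h2]
      ring
  rw [e]
  exact h

lemma kerG_le_diff (X : ℕ) (hX : 1 ≤ X) (n : ℕ) (hn : 1 ≤ n) :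
    kerG (X / ((n + 1 : ℕ) : ℝ)) ≤ kerR X ((n + 1 : ℕ) : ℝ) - kerR X n := by
  have hn' : (1 : ℝ) ≤ n := by exact_mod_cast hn
  have h := (convex_Icc (n : ℝ) (n + 1)).mul_sub_le_image_sub_of_le_deriv
    (f := kerR X) (C := kerG (X / ((n + 1 : ℕ) : ℝ)))
    (fun y hy => (kerR_deriv X y hX (by linarith [hy.1])).continuousAt.continuousWithinAt)
    (fun y hy => by
      rw [interior_Icc] at hy
      exact (kerR_deriv X y hX (by linarith [hy.1])).differentiableAt.differentiableWithinAt)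
    (fun y hy => by
      rw [interior_Icc] at hy
      have := hy.1
      rw [(kerR_deriv X y hX (by linarith [hy.1])).deriv]
      apply kerG_mono
      push_cast
      have h2 := hy.2
      have h3 : 0 < y := by linarith
      gcongr
      ) n ⟨le_rfl, by linarith⟩ (n + 1) ⟨by linarith, le_rfl⟩ (by linarith)
  push_cast at h ⊢
  linarith

lemma kerR_one (X : ℕ) (hX : 1 ≤ X) : -(X / 4 : ℝ) ≤ kerR X 1 := by
  have hX' : (1 : ℝ) ≤ X := by exact_mod_cast hX
  have h : ∀ n : ℕ, ∑ j ∈ Icc 1 n, (1 - (j : ℝ) / X) ^ 3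
      = (n : ℝ) - 3 * ((n : ℝ) * (n + 1) / 2) / (X : ℝ)
        + 3 * ((n : ℝ) * (n + 1) * (2 * n + 1) / 6) / (X : ℝ) ^ 2
        - ((n : ℝ) * (n + 1) / 2) ^ 2 / (X : ℝ) ^ 3 := by
    intro n
    induction n with
    | zero => simp
    | succ n ih =>
      rw [sum_Icc_succ_top (by omega), ih]
      push_cast
      field_simp
      ring
  unfold kerR
  have e : ∑ j ∈ Icc 1 X, (1 : ℝ) * (max 0 (1 - (j : ℝ) * 1 / X)) ^ 3
      = ∑ j ∈ Icc 1 X, (1 - (j : ℝ) / X) ^ 3 := by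
    apply sum_congr rfl
    intro j hj
    rw [mem_Icc] at hj
    have h1 : (j : ℝ) ≤ X := by exact_mod_cast hj.2
    rw [mul_one, max_eq_right, one_mul]
    rw [sub_nonneg, div_le_one (by linarith)]; exact h1
  rw [e, h X]
  have : (X : ℝ) - 3 * ((X : ℝ) * (X + 1) / 2) / (X : ℝ)
        + 3 * ((X : ℝ) * (X + 1) * (2 * X + 1) / 6) / (X : ℝ) ^ 2
        - ((X : ℝ) * (X + 1) / 2) ^ 2 / (X : ℝ) ^ 3 = ((X : ℝ) - 1) ^ 2 / (4 * X) := by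
    field_simp; ring
  rw [this]
  rw [neg_le_neg_iff, div_le_iff₀ (by positivity)]
  nlinarith

lemma kerR_nonpos (X : ℕ) (u : ℝ) (hu : 0 ≤ u) : kerR X u ≤ 0 := by
  unfold kerR
  rw [neg_nonpos]
  apply sum_nonneg
  intro j _
  have : (0 : ℝ) ≤ max 0 (1 - j * u / X) := le_max_left _ _
  positivity

lemma sum_kerG_le (X : ℕ) (hX : 1 ≤ X) :
    ∑ n ∈ Icc 1 X, kerG (X / n) ≤ X / 4 + 1 / 2 := by
  have h : ∀ N : ℕ, 1 ≤ N → ∑ n ∈ Icc 1 N, kerG (X / n) ≤ 1 / 2 + (kerR X N - kerR X 1) := by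
    intro N hN
    induction N, hN using Nat.le_induction with
    | base => simpa using kerG_le_half X
    | succ N hN ih =>
      rw [sum_Icc_succ_top (by omega)]
      linarith [kerG_le_diff X hX N hN]
  have := h X hX
  linarith [kerR_one X hX, kerR_nonpos X X (by positivity)]


lemma swap_sum (X : ℕ) (f : ℕ → ℕ → ℝ) :
    ∑ N ∈ Icc 1 X, ∑ d ∈ N.divisors, f d N
      = ∑ d ∈ Icc 1 X, ∑ j ∈ Icc 1 (X / d), f d (d * j) := by
  rw [sum_sigma', sum_sigma']
  refine sum_bij' (fun a _ => ⟨a.2, a.1 / a.2⟩) (fun a _ => ⟨a.1 * a.2, a.1⟩) ?_ ?_ ?_ ?_ ?_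
  · rintro ⟨N, d⟩ h
    simp only [mem_sigma, mem_Icc, Nat.mem_divisors] at h ⊢
    obtain ⟨⟨h1, h2⟩, ⟨e, rfl⟩, h3⟩ := h
    have hd : 0 < d := by rcases Nat.eq_zero_or_pos d with h | h; simp [h] at h3; exact h
    have he : 0 < e := by rcases Nat.eq_zero_or_pos e with h | h; simp [h] at h3; exact h
    rw [Nat.mul_div_cancel_left _ hd]
    refine ⟨⟨hd, ?_⟩, he, ?_⟩
    · nlinarith
    · rw [Nat.le_div_iff_mul_le hd]; linarith
  · rintro ⟨d, j⟩ h
    simp only [mem_sigma, mem_Icc, Nat.mem_divisors] at h ⊢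
    obtain ⟨⟨h1, h2⟩, h3, h4⟩ := h
    rw [Nat.le_div_iff_mul_le (by omega)] at h4
    refine ⟨⟨by nlinarith, by linarith⟩, Dvd.intro _ rfl, by positivity⟩
  · rintro ⟨N, d⟩ h
    simp only [mem_sigma, mem_Icc, Nat.mem_divisors] at h ⊢
    rw [Nat.mul_div_cancel' h.2.1]
  · rintro ⟨d, j⟩ h
    simp only [mem_sigma, mem_Icc, Nat.mem_divisors] at h ⊢
    rw [Nat.mul_div_cancel_left _ (by omega)]
  · rintro ⟨N, d⟩ h
    simp only [mem_sigma, mem_Icc, Nat.mem_divisors] at h ⊢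
    rw [Nat.mul_div_cancel' h.2.1]

lemma sum_vonMangoldt_kerG (X : ℕ) :
    ∑ n ∈ Icc 1 X, ArithmeticFunction.vonMangoldt n * kerG (X / n)
      = ∑ N ∈ Icc 1 X, Real.log N * kerA (N / X) := by
  have h := swap_sum X (fun d N => ArithmeticFunction.vonMangoldt d * kerA (N / X))
  simp only [← sum_mul, ArithmeticFunction.vonMangoldt_sum] at h
  rw [h]
  apply sum_congr rfl
  intro d hd
  rw [mem_Icc] at hd
  rw [← mul_sum]
  congr 1
  unfold kerG
  rw [Nat.floor_div_eq_div]
  apply sum_congr rfl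
  intro j _
  congr 1
  have : (d : ℝ) ≠ 0 := by have := hd.1; positivity
  have : (X : ℝ) ≠ 0 := by have := hd.1.trans hd.2; positivity
  push_cast
  field_simp

lemma abel_log (X n : ℕ) (a : ℕ → ℝ) :
    ∑ N ∈ Icc 1 (n + 1), Real.log N * a N
      = ∑ k ∈ Icc 1 n, (Real.log (k + 1 : ℕ) - Real.log k)
          * (∑ N ∈ Icc 1 (n + 1), a N - ∑ N ∈ Icc 1 k, a N) := by
  have key : ∀ C : ℝ, ∑ k ∈ Icc 1 n, (Real.log (k + 1 : ℕ) - Real.log k)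
          * (C - ∑ N ∈ Icc 1 k, a N) = ∑ N ∈ Icc 1 (n + 1), Real.log N * a N
          + Real.log (n + 1 : ℕ) * (C - ∑ N ∈ Icc 1 (n + 1), a N) := by
    intro C
    induction n with
    | zero => simp
    | succ n ih =>
      rw [sum_Icc_succ_top (by omega), ih, sum_Icc_succ_top (b := n + 1) (by omega) (fun N => Real.log N * a N),
        sum_Icc_succ_top (b := n + 1) (by omega) a]
      ring
  rw [key]; ring

lemma log_diff (k : ℕ) (hk : 1 ≤ k) : 1 / ((k : ℝ) + 1 / 2) ≤ Real.log (k + 1 : ℕ) - Real.log k := by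
  have hk' : (1 : ℝ) ≤ k := by exact_mod_cast hk
  rw [← Real.log_div (by positivity) (by positivity)]
  have h := Real.le_log_one_add_of_nonneg (x := 1 / (k : ℝ)) (by positivity)
  have e : ((k + 1 : ℕ) : ℝ) / k = 1 + 1 / k := by push_cast; field_simp
  rw [e]
  refine le_trans (le_of_eq ?_) h
  field_simp
  ring

lemma V_lower (X : ℕ) (hX : 2 ≤ X) :
    (X : ℝ) / 4 - 2 ≤ ∑ N ∈ Icc 1 X, Real.log N * kerA (N / X) := by
  obtain ⟨n, rfl⟩ : ∃ n, X = n + 1 := ⟨X - 1, by omega⟩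
  set X := n + 1 with hXd
  have hX' : (2 : ℝ) ≤ X := by exact_mod_cast hX
  rw [abel_log X n (fun N => kerA (N / X))]
  have step : ∀ k ∈ Icc 1 n, (1 - ((k : ℝ) + 1 / 2) / X) ^ 3 - 1 / X ≤
      (Real.log (k + 1 : ℕ) - Real.log k)
          * (∑ N ∈ Icc 1 (n + 1), kerA (N / X) - ∑ N ∈ Icc 1 k, kerA (N / X)) := by
    intro k hk
    rw [mem_Icc] at hk
    have hk' : (1 : ℝ) ≤ k := by exact_mod_cast hk.1
    have hkX : (k : ℝ) + 1 ≤ X := by rw [hXd]; exact_mod_cast Nat.succ_le_succ hk.2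
    rw [sum_kerA _ _ (by linarith), sum_kerA _ _ (by linarith)]
    have e1 : kerF ((n + 1 : ℕ) : ℝ) X - kerF k X
        = (X - k) * (X - k - 1) * (X * (X - k - 1 / 2) - (X - k) * (X - k - 1)) / X ^ 3 := by
      rw [← hXd]; unfold kerF; field_simp; ring
    have hnn : 0 ≤ kerF ((n + 1 : ℕ) : ℝ) X - kerF k X := by
      rw [e1]
      have h1 : 0 ≤ (X : ℝ) - k := by linarith
      have h2 : 0 ≤ (X : ℝ) - k - 1 := by linarith
      have h3 : 0 ≤ (X : ℝ) * (X - k - 1 / 2) - (X - k) * (X - k - 1) := by nlinarith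
      positivity
    refine le_trans ?_ (mul_le_mul_of_nonneg_right (log_diff k hk.1) hnn)
    have e2 : 1 / ((k : ℝ) + 1 / 2) * (kerF ((n + 1 : ℕ) : ℝ) X - kerF k X)
        = (1 - ((k : ℝ) + 1 / 2) / X) ^ 3
          + ((1 - ((k : ℝ) + 1 / 2) / X) * (1 - 2 * (((k : ℝ) + 1 / 2) / X)) / 4
            - 1 / (16 * X ^ 2)) / (X * (k + 1 / 2)) := by
      rw [e1]; field_simp; ring
    rw [e2]
    have h5 : -1 ≤ (1 - ((k : ℝ) + 1 / 2) / X) * (1 - 2 * (((k : ℝ) + 1 / 2) / X)) / 4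
            - 1 / (16 * (X : ℝ) ^ 2) := by
      have : 1 / (16 * (X : ℝ) ^ 2) ≤ 1 / 16 := by
        apply one_div_le_one_div_of_le (by norm_num); nlinarith
      nlinarith [sq_nonneg (4 * (((k : ℝ) + 1 / 2) / X) - 3)]
    have h6 : -(1 / (X : ℝ)) ≤ ((1 - ((k : ℝ) + 1 / 2) / X) * (1 - 2 * (((k : ℝ) + 1 / 2) / X)) / 4
            - 1 / (16 * X ^ 2)) / (X * (k + 1 / 2)) := by
      rw [le_div_iff₀ (by positivity)]
      refine le_trans ?_ h5
      field_simp
      linarith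
    linarith
  refine le_trans ?_ (sum_le_sum step)
  rw [sum_sub_distrib]
  have h : ∀ k : ℕ, ∑ j ∈ Icc 1 k, (1 - ((j : ℝ) + 1 / 2) / X) ^ 3
      = (X : ℝ) / 4 * ((1 - 1 / (X : ℝ)) ^ 4 - (1 - ((k : ℝ) + 1) / X) ^ 4)
        - 1 / (8 * (X : ℝ)) * ((1 - 1 / (X : ℝ)) ^ 2 - (1 - ((k : ℝ) + 1) / X) ^ 2) := by
    intro k
    induction k with
    | zero => simp
    | succ n ih =>
      rw [sum_Icc_succ_top (by omega), ih]
      push_cast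
      field_simp
      ring
  rw [h n]
  have e3 : (n : ℝ) + 1 = X := by rw [hXd]; push_cast; ring
  rw [e3, div_self (by linarith)]
  have e4 : ∑ j ∈ Icc 1 n, 1 / (X : ℝ) = (X - 1) / X := by
    simp; rw [← e3]; field_simp; ring
  rw [e4]
  have hp : (0:ℝ) < X := by linarith
  have b1 : 1 - 4 / (X : ℝ) ≤ (1 - 1 / (X : ℝ)) ^ 4 := by
    have := one_add_mul_le_pow (a := -(1 / (X : ℝ))) (by
      have : 1 / (X : ℝ) ≤ 1 := by rw [div_le_one hp]; linarith
      linarith) 4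
    calc _ = 1 + ((4 : ℕ) : ℝ) * -(1 / (X : ℝ)) := by push_cast; ring
      _ ≤ _ := this
      _ = _ := by ring
  have b2 : (X : ℝ) / 4 * (1 - 4 / X) ≤ X / 4 * (1 - 1 / (X : ℝ)) ^ 4 :=
    mul_le_mul_of_nonneg_left b1 (by linarith)
  have b3 : (X : ℝ) / 4 * (1 - 4 / X) = X / 4 - 1 := by field_simp
  have b4 : ((X : ℝ) - 1) / X = 1 - 1 / X := by field_simp
  have b5 : 1 / (8 * (X : ℝ)) * ((1 - 1 / (X : ℝ)) ^ 2) ≤ 1 / (8 * (X : ℝ)) * 1 := by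
    apply mul_le_mul_of_nonneg_left _ (by positivity)
    have : 1 / (X : ℝ) ≤ 1 := by rw [div_le_one hp]; linarith
    have : 0 ≤ 1 / (X : ℝ) := by positivity
    nlinarith
  have b6 : 1 / (8 * (X : ℝ)) ≤ 1 / X := by
    apply one_div_le_one_div_of_le hp; linarith
  norm_num at *
  linarith

lemma psi_sub_theta_le4 (x : ℝ) (hx : 10000 ≤ x) :
    Chebyshev.psi x - Chebyshev.theta x ≤ 4 * √x := by
  have h := Chebyshev.psi_sub_theta_le_psi_add_psi_add_psi x
  have hx0 : 0 < x := by linarith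
  have hs : 100 ≤ √x := by
    apply Real.le_sqrt_of_sq_le; linarith
  set s := √x with hsd
  have e2 : x ^ (2 : ℝ)⁻¹ = s := by rw [hsd, Real.sqrt_eq_rpow]; norm_num
  have log4 : Real.log 4 ≤ 1.38630 := by
    have : Real.log 4 = 2 * Real.log 2 := by
      rw [show (4 : ℝ) = 2 ^ 2 by norm_num, Real.log_pow]; norm_num
    have := Real.log_two_lt_d9
    linarith
  have p2 : Chebyshev.psi s ≤ 2.33 * s := by
    refine (Chebyshev.psi_le (by linarith)).trans ?_
    have hv : 10 ≤ √s := by apply Real.le_sqrt_of_sq_le; linarith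
    have hv2 : √s * √s = s := Real.mul_self_sqrt (by linarith)
    set v := √s
    have hl : Real.log s ≤ 0.47 * v := by
      rw [← hv2, Real.log_mul (by linarith) (by linarith)]
      have h1 : Real.log v = Real.log (v / 10) + Real.log 10 := by
        rw [← Real.log_mul (by positivity) (by norm_num)]; congr 1; field_simp
      have h2 := Real.log_le_sub_one_of_pos (x := v / 10) (by positivity)
      have h3 : Real.log 10 ≤ 2.31 := by
        rw [Real.log_le_iff_le_exp (by norm_num)]
        have : Real.exp 2.31 = Real.exp 1 ^ 2 * Real.exp 0.31 := by
          rw [← Real.exp_nat_mul, ← Real.exp_add]; norm_num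
        rw [this]
        have h4 := Real.exp_one_gt_d9
        have h5 := Real.quadratic_le_exp_of_nonneg (x := 0.31) (by norm_num)
        have h6 : (2.7182818283 : ℝ) ^ 2 ≤ Real.exp 1 ^ 2 := by gcongr
        nlinarith
      nlinarith
    have h7 : 2 * v * Real.log s ≤ 0.94 * s := by
      have := mul_le_mul_of_nonneg_left hl (show 0 ≤ 2 * v by linarith)
      nlinarith
    nlinarith
  have p3 : x ^ (3 : ℝ)⁻¹ ≤ s / 4.6 := by
    rw [le_div_iff₀ (by norm_num), ← e2]
    have : (4.6 : ℝ) ≤ x ^ (6 : ℝ)⁻¹ := by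
      rw [Real.le_rpow_inv_iff_of_pos (by norm_num) hx0.le (by norm_num)]
      norm_num; norm_num at hx; linarith
    calc _ ≤ x ^ (3 : ℝ)⁻¹ * x ^ (6 : ℝ)⁻¹ := by gcongr
      _ = _ := by rw [← Real.rpow_add hx0]; norm_num
  have p5 : x ^ (5 : ℝ)⁻¹ ≤ s / 15 := by
    rw [le_div_iff₀ (by norm_num), ← e2]
    have : (15 : ℝ) ≤ x ^ (3 / 10 : ℝ) := by
      calc (15 : ℝ) ≤ 10000 ^ (3 / 10 : ℝ) := by
            rw [show (3 / 10 : ℝ) = 3 * (10 : ℝ)⁻¹ by norm_num, Real.rpow_mul (by norm_num),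
              Real.le_rpow_inv_iff_of_pos (by norm_num) (by positivity) (by norm_num)]
            norm_num
        _ ≤ _ := by gcongr
    calc _ ≤ x ^ (5 : ℝ)⁻¹ * x ^ (3 / 10 : ℝ) := by gcongr
      _ = _ := by rw [← Real.rpow_add hx0]; norm_num
  have q3 := Chebyshev.psi_le_const_mul_self (x := x ^ (3 : ℝ)⁻¹) (by positivity)
  have q5 := Chebyshev.psi_le_const_mul_self (x := x ^ (5 : ℝ)⁻¹) (by positivity)
  have r3 : (Real.log 4 + 4) * x ^ (3 : ℝ)⁻¹ ≤ 5.3863 * (s / 4.6) := by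
    gcongr; linarith
  have r5 : (Real.log 4 + 4) * x ^ (5 : ℝ)⁻¹ ≤ 5.3863 * (s / 15) := by
    gcongr; linarith
  rw [e2] at h
  norm_num at r3 r5 p2
  linarith

lemma main_lower (X : ℕ) (hX : 10000 ≤ X) :
    (X : ℝ) / 4 - 2 - 2 * √X ≤
      ∑ p ∈ (Icc 1 X).filter Nat.Prime, Real.log p * kerG (X / p) := by
  have h1 := V_lower X (by omega)
  rw [← sum_vonMangoldt_kerG, ← sum_filter_add_sum_filter_not _ Nat.Prime] at h1
  have h2 : ∑ n ∈ (Icc 1 X).filter Nat.Prime, ArithmeticFunction.vonMangoldt n * kerG (X / n)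
      = ∑ p ∈ (Icc 1 X).filter Nat.Prime, Real.log p * kerG (X / p) := by
    apply sum_congr rfl
    intro p hp
    rw [mem_filter] at hp
    rw [ArithmeticFunction.vonMangoldt_apply_prime hp.2]
  have h3 : ∑ n ∈ (Icc 1 X).filter (fun n => ¬ Nat.Prime n),
      ArithmeticFunction.vonMangoldt n * kerG (X / n) ≤ 2 * √X := by
    have h4 := psi_sub_theta_le4 X (by exact_mod_cast hX)
    rw [Chebyshev.psi_sub_theta_eq_sum_not_prime, Nat.floor_natCast] at h4
    have e : Ioc 0 X = Icc 1 X := rfl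
    rw [e] at h4
    calc _ ≤ ∑ n ∈ (Icc 1 X).filter (fun n => ¬ Nat.Prime n),
          ArithmeticFunction.vonMangoldt n * (1 / 2) := by
          apply sum_le_sum
          intro n _
          exact mul_le_mul_of_nonneg_left (kerG_le_half _) ArithmeticFunction.vonMangoldt_nonneg
      _ ≤ _ := by rw [← sum_mul]; linarith
  linarith


lemma abel_ineq (m S : ℝ) (g : ℕ → ℝ)
    (hπ : ∀ n : ℕ, 1 ≤ n → m * ((Icc 1 n).filter Nat.Prime).card ≤ n + S)
    (hg : ∀ n, 1 ≤ n → g (n + 1) ≤ g n) (X : ℕ) (hX : 1 ≤ X) (hgX : 0 ≤ g X) :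
    m * ∑ p ∈ (Icc 1 X).filter Nat.Prime, g p ≤ ∑ n ∈ Icc 1 X, g n + S * g 1 := by
  have key : ∀ n : ℕ, 1 ≤ n → ((n : ℝ) - m * ((Icc 1 n).filter Nat.Prime).card + S) * g n ≤
      ∑ n ∈ Icc 1 n, g n - m * ∑ p ∈ (Icc 1 n).filter Nat.Prime, g p + S * g 1 := by
    intro n hn
    induction n, hn using Nat.le_induction with
    | base =>
      have : (Icc 1 1).filter Nat.Prime = ∅ := by decide
      rw [this]; simp; linarith
    | succ n hn ih =>
      have h1 := mul_le_mul_of_nonneg_left (hg n hn)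
        (show 0 ≤ (n : ℝ) - m * ((Icc 1 n).filter Nat.Prime).card + S by linarith [hπ n hn])
      have hI : Icc 1 (n + 1) = insert (n + 1) (Icc 1 n) := by
        ext x; simp; omega
      have hnot : n + 1 ∉ Icc 1 n := by simp
      rw [hI, filter_insert, sum_insert hnot]
      split_ifs with hp
      · have hnot2 : n + 1 ∉ (Icc 1 n).filter Nat.Prime := by simp
        rw [sum_insert hnot2, card_insert_of_notMem hnot2]
        push_cast
        nlinarith
      · push_cast
        nlinarith
  have h := key X hX
  have := mul_nonneg (show 0 ≤ (X : ℝ) - m * ((Icc 1 X).filter Nat.Prime).card + S by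
    linarith [hπ X hX]) hgX
  linarith

lemma U_lower (X : ℕ) :
    ∑ i ∈ Icc 1 12, Real.log (4 / 3) *
        ∑ p ∈ (Icc 1 ⌊(X : ℝ) / (4 / 3) ^ i⌋₊).filter Nat.Prime,
          kerG ((⌊(X : ℝ) / (4 / 3) ^ i⌋₊ : ℕ) / p)
      ≤ ∑ p ∈ (Icc 1 X).filter Nat.Prime, Real.log (X / p) * kerG (X / p) := by
  have hlr : 0 < Real.log (4 / 3) := Real.log_pos (by norm_num)
  have h1 : ∀ i ∈ Icc 1 12, Real.log (4 / 3) *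
        ∑ p ∈ (Icc 1 ⌊(X : ℝ) / (4 / 3) ^ i⌋₊).filter Nat.Prime,
          kerG ((⌊(X : ℝ) / (4 / 3) ^ i⌋₊ : ℕ) / p)
      ≤ ∑ p ∈ (Icc 1 X).filter Nat.Prime,
          Real.log (4 / 3) * (if (4 / 3 : ℝ) ^ i ≤ X / p then kerG (X / p) else 0) := by
    intro i _
    rw [← mul_sum]
    apply mul_le_mul_of_nonneg_left _ hlr.le
    have hfl : ((⌊(X : ℝ) / (4 / 3) ^ i⌋₊ : ℕ) : ℝ) ≤ X / (4 / 3) ^ i :=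
      Nat.floor_le (by positivity)
    have hr1 : (1 : ℝ) ≤ (4 / 3) ^ i := one_le_pow₀ (by norm_num)
    have hle : X / (4 / 3 : ℝ) ^ i ≤ X := div_le_self (by positivity) hr1
    have hsub : (Icc 1 ⌊(X : ℝ) / (4 / 3) ^ i⌋₊).filter Nat.Prime ⊆ (Icc 1 X).filter Nat.Prime := by
      apply filter_subset_filter
      apply Icc_subset_Icc_right
      exact_mod_cast hfl.trans hle
    calc _ ≤ ∑ p ∈ (Icc 1 ⌊(X : ℝ) / (4 / 3) ^ i⌋₊).filter Nat.Prime,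
          (if (4 / 3 : ℝ) ^ i ≤ X / p then kerG (X / p) else 0) := by
          apply sum_le_sum
          intro p hp
          simp only [mem_filter, mem_Icc] at hp
          have hp0 : (0 : ℝ) < p := by exact_mod_cast hp.1.1
          have hpl : (p : ℝ) ≤ X / (4 / 3) ^ i := le_trans (by exact_mod_cast hp.1.2) hfl
          rw [if_pos]
          · apply kerG_mono
            exact div_le_div_of_nonneg_right (hfl.trans hle) hp0.le
          · rw [le_div_iff₀ (by positivity)] at hpl ⊢
            linarith
      _ ≤ _ := by
          apply sum_le_sum_of_subset_of_nonneg hsub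
          intro p _ _
          split_ifs
          · exact kerG_nonneg _
          · exact le_rfl
  refine (sum_le_sum h1).trans ?_
  rw [sum_comm]
  apply sum_le_sum
  intro p hp
  simp only [mem_filter, mem_Icc] at hp
  have hp0 : (0 : ℝ) < p := by exact_mod_cast hp.1.1
  have hy : (1 : ℝ) ≤ X / p := by
    rw [le_div_iff₀ hp0, one_mul]; exact_mod_cast hp.1.2
  set y : ℝ := X / p
  rw [← mul_sum, ← sum_filter, sum_const, nsmul_eq_mul, ← mul_assoc]
  apply mul_le_mul_of_nonneg_right _ (kerG_nonneg _)
  have hsub : (Icc 1 12).filter (fun i => (4 / 3 : ℝ) ^ i ≤ y)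
      ⊆ Icc 1 ⌊Real.log y / Real.log (4 / 3)⌋₊ := by
    intro i hi
    simp only [mem_filter, mem_Icc] at hi ⊢
    refine ⟨hi.1.1, ?_⟩
    apply Nat.le_floor
    rw [le_div_iff₀ hlr, ← Real.log_pow]
    exact Real.log_le_log (by positivity) hi.2
  have hc := card_le_card hsub
  rw [Nat.card_Icc, Nat.add_sub_cancel] at hc
  have hc2 : (((Icc 1 12).filter (fun i => (4 / 3 : ℝ) ^ i ≤ y)).card : ℝ)
      ≤ Real.log y / Real.log (4 / 3) :=
    le_trans (by exact_mod_cast hc) (Nat.floor_le (div_nonneg (Real.log_nonneg hy) hlr.le))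
  rw [le_div_iff₀ hlr] at hc2
  linarith

lemma exp_big (m : ℕ) (hm : 15 ≤ m) : 8100 * (m : ℝ) ^ 2 + 2 ≤ Real.exp ((m : ℝ) - 1 / 3) := by
  induction m, hm using Nat.le_induction with
  | base =>
    have h1 : Real.exp (((15 : ℕ) : ℝ) - 1 / 3) ^ 3 = Real.exp 1 ^ 44 := by
      rw [← Real.exp_nat_mul, ← Real.exp_nat_mul]; norm_num
    have h2 : (2.718 : ℝ) ^ 44 ≤ Real.exp 1 ^ 44 := by
      gcongr; linarith [Real.exp_one_gt_d9]
    by_contra hc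
    push Not at hc
    have h3 := pow_le_pow_left₀ (Real.exp_pos _).le hc.le 3
    rw [h1] at h3
    norm_num at h2 h3
    linarith
  | succ n hn ih =>
    have hn' : (15 : ℝ) ≤ n := by exact_mod_cast hn
    have h : Real.exp (((n + 1 : ℕ) : ℝ) - 1 / 3) = Real.exp ((n : ℝ) - 1 / 3) * Real.exp 1 := by
      rw [← Real.exp_add]; push_cast; ring_nf
    rw [h]
    have h2 : (2 : ℝ) ≤ Real.exp 1 := by linarith [Real.exp_one_gt_d9]
    have h3 := mul_le_mul ih h2 (by norm_num) (Real.exp_pos _).le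
    push_cast
    nlinarith

lemma step_lower (m X : ℕ) (hm : 0 ≤ (m : ℝ)) (hX1 : (1822500 : ℝ) ≤ X)
    (hL : Real.log X ≤ m) (i : ℕ) (hi : i ≤ 12) :
    2 / 7 * ((X : ℝ) / 4 * (3 / 4) ^ i - 9 / 4 - 2 * √(X : ℝ)) ≤
      m * (Real.log (4 / 3) * ∑ p ∈ (Icc 1 ⌊(X : ℝ) / (4 / 3) ^ i⌋₊).filter Nat.Prime,
          kerG ((⌊(X : ℝ) / (4 / 3) ^ i⌋₊ : ℕ) / p)) := by
  have hlog : 2 / 7 ≤ Real.log (4 / 3) := by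
    have h := Real.le_log_one_add_of_nonneg (x := 1 / 3) (by norm_num)
    norm_num at h ⊢
    linarith
  set Y := ⌊(X : ℝ) / (4 / 3) ^ i⌋₊ with hY
  have e : (X : ℝ) / (4 / 3) ^ i = X * (3 / 4) ^ i := by
    rw [div_eq_mul_inv, ← inv_pow]; norm_num
  have hY1 : (X : ℝ) * (3 / 4) ^ i < Y + 1 := by rw [← e]; exact Nat.lt_floor_add_one _
  have hY2 : (Y : ℝ) ≤ X * (3 / 4) ^ i := by rw [← e]; exact Nat.floor_le (by positivity)
  have hY3 : (Y : ℝ) ≤ X := by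
    have : ((3 : ℝ) / 4) ^ i ≤ 1 := pow_le_one₀ (by norm_num) (by norm_num)
    nlinarith
  have hY4 : ((10000 : ℕ) : ℝ) ≤ Y := by
    have h12 : ((3 : ℝ) / 4) ^ 12 ≤ (3 / 4) ^ i :=
      pow_le_pow_of_le_one (by norm_num) (by norm_num) hi
    have := mul_le_mul hX1 h12 (by positivity) (by linarith)
    norm_num at this ⊢
    have h9 : (10000 : ℝ) ≤ Y := by linarith
    exact_mod_cast h9
  have hYn : 10000 ≤ Y := by exact_mod_cast hY4
  have h1 := main_lower Y hYn
  have h2 : √(Y : ℝ) ≤ √(X : ℝ) := Real.sqrt_le_sqrt hY3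
  have h3 : ∑ p ∈ (Icc 1 Y).filter Nat.Prime, Real.log p * kerG (Y / p)
      ≤ m * ∑ p ∈ (Icc 1 Y).filter Nat.Prime, kerG (Y / p) := by
    rw [mul_sum]
    apply sum_le_sum
    intro p hp
    simp only [mem_filter, mem_Icc] at hp
    have hp0 : (0 : ℝ) < p := by exact_mod_cast hp.1.1
    have hpY : (p : ℝ) ≤ Y := by exact_mod_cast hp.1.2
    apply mul_le_mul_of_nonneg_right _ (kerG_nonneg _)
    have := Real.log_le_log hp0 (hpY.trans hY3)
    linarith
  have h0 : 0 ≤ ∑ p ∈ (Icc 1 Y).filter Nat.Prime, kerG (Y / p) :=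
    sum_nonneg fun p _ => kerG_nonneg _
  generalize ∑ p ∈ (Icc 1 Y).filter Nat.Prime, kerG (Y / p) = TY at h3 h0 ⊢
  have h4 : 0 ≤ (m : ℝ) * TY := by positivity
  have h5 := mul_le_mul_of_nonneg_right hlog h4
  have h6 : 2 / 7 * ((X : ℝ) / 4 * (3 / 4) ^ i - 9 / 4 - 2 * √(X : ℝ)) ≤ 2 / 7 * (m * TY) := by
    apply mul_le_mul_of_nonneg_left _ (by norm_num)
    linarith
  linarith

lemma gen_case (m : ℕ) (hm : 15 ≤ m) (S : ℝ) (hS0 : 0 ≤ S)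
    (hS : S * m ≤ Real.exp ((m : ℝ) - 1) + m)
    (hπ : ∀ n : ℕ, 1 ≤ n → (m : ℝ) * ((Icc 1 n).filter Nat.Prime).card ≤ n + S) : False := by
  have hm' : (15 : ℝ) ≤ m := by exact_mod_cast hm
  have hE := exp_big m hm
  set E := Real.exp ((m : ℝ) - 1 / 3) with hEd
  set X := ⌊E⌋₊ with hXd
  have hE0 : 0 < E := Real.exp_pos _
  have hXE : (X : ℝ) ≤ E := Nat.floor_le hE0.le
  have hEX : E < X + 1 := Nat.lt_floor_add_one E
  have hXm : 8100 * (m : ℝ) ^ 2 ≤ X := by linarith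
  have hX0 : (0 : ℝ) < X := by nlinarith
  set s := √(X : ℝ) with hsd
  have hs2 : s * s = X := Real.mul_self_sqrt hX0.le
  have hs : 90 * (m : ℝ) ≤ s := by
    apply Real.le_sqrt_of_sq_le; linarith
  have hL : Real.log X ≤ m - 1 / 3 := by
    rw [Real.log_le_iff_le_exp hX0]; exact hXE
  have hXn : 1 ≤ X := by exact_mod_cast hX0
  have hX1 : (1822500 : ℝ) ≤ X := by nlinarith
  -- the exponential
  have hexp : Real.exp ((m : ℝ) - 1) ≤ 0.5136 * (X + 1) := by
    have h1 : Real.exp ((m : ℝ) - 1) * Real.exp (2 / 3) = E := by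
      rw [hEd, ← Real.exp_add]; ring_nf
    have h2 : 1.9472 ≤ Real.exp (2 / 3) := by
      have h3 : Real.exp (2 / 3) ^ 3 = Real.exp 1 ^ 2 := by
        rw [← Real.exp_nat_mul, ← Real.exp_nat_mul]; norm_num
      have h4 : (2.7182818283 : ℝ) ^ 2 ≤ Real.exp 1 ^ 2 := by
        gcongr; linarith [Real.exp_one_gt_d9]
      by_contra hc
      push Not at hc
      have h5 := pow_le_pow_left₀ (Real.exp_pos _).le hc.le 3
      rw [h3] at h5
      norm_num at h4 h5
      linarith
    have h6 := mul_le_mul_of_nonneg_left h2 (Real.exp_pos ((m : ℝ) - 1)).le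
    norm_num at *
    linarith
  -- upper bound for T
  set T := ∑ p ∈ (Icc 1 X).filter Nat.Prime, kerG (X / p) with hT
  have hT0 : 0 ≤ T := sum_nonneg fun p _ => kerG_nonneg _
  have hTu : (m : ℝ) * T ≤ X / 4 + 1 / 2 + S / 2 := by
    have h1 := abel_ineq m S (fun n => kerG (X / n)) hπ (by
      intro n hn
      apply kerG_mono
      have : (0 : ℝ) < n := by exact_mod_cast hn
      push_cast
      gcongr
      linarith) X hXn (kerG_nonneg _)
    have h2 := sum_kerG_le X hXn
    have h3 := mul_le_mul_of_nonneg_left (kerG_le_half ((X : ℝ) / (1 : ℕ))) hS0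
    linarith
  set U := ∑ p ∈ (Icc 1 X).filter Nat.Prime, Real.log (X / p) * kerG (X / p) with hU
  have hLTU : ∑ p ∈ (Icc 1 X).filter Nat.Prime, Real.log p * kerG (X / p)
      = Real.log X * T - U := by
    rw [hT, hU, mul_sum, ← sum_sub_distrib]
    apply sum_congr rfl
    intro p hp
    simp only [mem_filter, mem_Icc] at hp
    have hp0 : (0 : ℝ) < p := by exact_mod_cast hp.1.1
    rw [Real.log_div hX0.ne' hp0.ne']
    ring
  have hml := main_lower X (by
    have : ((10000 : ℕ) : ℝ) ≤ X := by push_cast; linarith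
    exact_mod_cast this)
  rw [hLTU] at hml
  have hUu : (m : ℝ) * U ≤ -X / 12 + 3 * m + 2 * m * s + 0.2568 * (X + 1) := by
    have h1 : (m : ℝ) * T * Real.log X ≤ (X / 4 + 1 / 2 + S / 2) * (m - 1 / 3) := by
      apply mul_le_mul hTu hL (Real.log_nonneg (by linarith)) (by positivity)
    have h2 := mul_le_mul_of_nonneg_left hml (show (0 : ℝ) ≤ m by linarith)
    norm_num at *
    nlinarith
  -- lower bound for U
  have hUl := U_lower X
  have hsum := sum_le_sum fun i (hi : i ∈ Icc 1 12) =>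
    step_lower m X (by linarith) hX1 (by linarith) i (mem_Icc.1 hi).2
  rw [← mul_sum, ← mul_sum] at hsum
  have hmU := mul_le_mul_of_nonneg_left hUl (show (0 : ℝ) ≤ m by linarith)
  have hfin := hsum.trans hmU
  rw [← hU, ← hsd] at hfin
  have hgeo : ∑ i ∈ Icc 1 12, ((3 : ℝ) / 4) ^ i ≥ 2.9049 := by
    norm_num [sum_Icc_succ_top]
  rw [sum_sub_distrib, sum_sub_distrib, ← mul_sum, sum_const, sum_const, Nat.card_Icc] at hfin
  have h7 := mul_le_mul_of_nonneg_left hgeo hX0.le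
  norm_num at hfin h7 hUu
  have h8 : (90 * (m : ℝ)) * s ≤ X := by rw [← hs2]; gcongr
  have h9 : (0 : ℝ) < s := by linarith
  clear hUl hsum hmU hU hT hLTU hml hTu
  nlinarith


/-- The product of the primes below `363`. -/
def bigP : ℕ := 33145029365917644537041586451002838777754047982048976093256545773949681076083753038263261851007891975336318712022358509317861766127318306017798990

/-- Number of integers coprime to `bigP` among the `2 ^ l` numbers `s, s + 2, s + 4, …`. -/
def cntP : ℕ → ℕ → ℕ
  | 0, s => bif Nat.beq (Nat.gcd s bigP) 1 then 1 else 0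
  | l + 1, s => cntP l s + cntP l (s + 2 ^ (l + 1))

lemma bigP_dvd (q : ℕ) (hq : q.Prime) (h : q ≤ 362) : q ∣ bigP := by
  revert hq
  interval_cases q <;> first | (intro _; unfold bigP; norm_num; done) | (intro hq; exfalso; revert hq; norm_num)

lemma prime_of_coprime (n : ℕ) (h1 : 1 < n) (h2 : n < 363 ^ 2) (h : Nat.gcd n bigP = 1) :
    n.Prime := by
  by_contra hn
  have hm := Nat.minFac_sq_le_self (by omega) hn
  have hp := Nat.minFac_prime (n := n) (by omega)
  have hle : n.minFac ≤ 362 := by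
    by_contra hc
    push Not at hc
    have : 363 ^ 2 ≤ n.minFac ^ 2 := Nat.pow_le_pow_left hc 2
    omega
  have hd := Nat.dvd_gcd (Nat.minFac_dvd n) (bigP_dvd _ hp hle)
  rw [h, Nat.dvd_one] at hd
  exact hp.one_lt.ne' hd

lemma cntP_le (l s : ℕ) (hs : 1 < s) (h : s + 2 ^ (l + 1) ≤ 363 ^ 2) :
    cntP l s ≤ ((Ico s (s + 2 ^ (l + 1))).filter Nat.Prime).card := by
  induction l generalizing s with
  | zero =>
    unfold cntP
    rcases hb : Nat.beq (Nat.gcd s bigP) 1 with _ | _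
    · simp
    · have h1 : Nat.gcd s bigP = 1 := Nat.eq_of_beq_eq_true hb
      have hp := prime_of_coprime s hs (by norm_num at h ⊢; omega) h1
      simp only [cond_true]
      rw [Nat.one_le_iff_ne_zero, card_ne_zero]
      exact ⟨s, by simp [hp]⟩
  | succ l ih =>
    unfold cntP
    have hpos : 0 < 2 ^ l := by positivity
    have e : 2 ^ (l + 1 + 1) = 2 ^ (l + 1) + 2 ^ (l + 1) := by ring
    have h1 := ih s hs (by omega)
    have h2 := ih (s + 2 ^ (l + 1)) (by omega) (by omega)
    rw [e, ← add_assoc, ← Ico_union_Ico_eq_Ico (b := s + 2 ^ (l + 1)) (by omega) (by omega),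
      filter_union, card_union_of_disjoint]
    · omega
    · apply disjoint_filter_filter
      exact Ico_disjoint_Ico_consecutive _ _ _

lemma card_lower (l c : ℕ) (hl : 3 + 2 ^ (l + 1) ≤ 363 ^ 2) (h : c ≤ cntP l 3) :
    c ≤ ((Icc 1 (2 + 2 ^ (l + 1))).filter Nat.Prime).card := by
  refine h.trans ((cntP_le l 3 (by norm_num) hl).trans (card_le_card ?_))
  apply filter_subset_filter
  intro x hx
  simp only [mem_Ico, mem_Icc] at hx ⊢
  omega

set_option maxRecDepth 100000 in
lemma c16 : 12179 ≤ cntP 16 3 := by decide +kernel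
lemma c12 : 956 ≤ cntP 12 3 := by decide +kernel
lemma d7 : 4 ≤ ((Icc 1 7).filter Nat.Prime).card := by decide +kernel
lemma d31 : 11 ≤ ((Icc 1 31).filter Nat.Prime).card := by decide +kernel
lemma d113 : 30 ≤ ((Icc 1 113).filter Nat.Prime).card := by decide +kernel
lemma d199 : 46 ≤ ((Icc 1 199).filter Nat.Prime).card := by decide +kernel

open Finset in
lemma nth_prime_ge (n : ℕ) : 2 * n + 1 ≤ Nat.nth Nat.Prime n := by
  rcases Nat.eq_zero_or_pos n with rfl | hn
  · rw [Nat.nth_prime_zero_eq_two]; norm_num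
  induction n, hn using Nat.le_induction with
  | base => rw [show Nat.succ 0 = 1 from rfl, Nat.nth_prime_one_eq_three]
  | succ n hn ih =>
    have h1 : Nat.nth Nat.Prime n < Nat.nth Nat.Prime (n + 1) :=
      Nat.nth_strictMono Nat.infinite_setOfPred_prime (Nat.lt_succ_self n)
    have p0 : (Nat.nth Nat.Prime n).Prime := Nat.prime_nth_prime n
    have p1 : (Nat.nth Nat.Prime (n + 1)).Prime := Nat.prime_nth_prime (n + 1)
    have hn1 : 1 ≤ n := hn
    have o0 := p0.eq_two_or_odd
    have o1 := p1.eq_two_or_odd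
    omega

open Finset in
lemma count_le (m : ℕ) (S : ℤ) (hm : 3 ≤ m)
    (hS : ∀ j : ℕ, 0 < j → (j : ℤ) * m - nthPrime j ≤ S) (n : ℕ) (hn : 1 ≤ n) :
    (m : ℤ) * ((Icc 1 n).filter Nat.Prime).card ≤ n + S := by
  have hS1 := hS 1 one_pos
  have e1 : nthPrime 1 = 2 := Nat.nth_prime_zero_eq_two
  rw [e1] at hS1
  push_cast at hS1
  have hc : ((Icc 1 n).filter Nat.Prime).card = Nat.count Nat.Prime (n + 1) := by
    rw [Nat.count_eq_card_filter_range]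
    congr 1
    ext x
    simp only [mem_filter, mem_Icc, mem_range]
    constructor
    · rintro ⟨⟨_, h2⟩, h3⟩; exact ⟨by omega, h3⟩
    · rintro ⟨h2, h3⟩; exact ⟨⟨h3.one_lt.le, by omega⟩, h3⟩
  rw [hc]
  rcases Nat.eq_zero_or_pos (Nat.count Nat.Prime (n + 1)) with h0 | hpos
  · rw [h0]; push_cast; omega
  · have h1 := hS _ hpos
    have h2 : nthPrime (Nat.count Nat.Prime (n + 1)) < n + 1 :=
      Nat.nth_lt_of_lt_count (by omega)
    have h3 : (nthPrime (Nat.count Nat.Prime (n + 1)) : ℤ) ≤ n := by exact_mod_cast Nat.le_of_lt_succ h2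
    rw [mul_comm]
    linarith

lemma k_bound (m k a b K : ℕ) (hm : 1 ≤ m) (hk : (k : ℝ) * ((m : ℝ) - 1) ^ 2 ≤ Real.exp ((m : ℝ) - 1))
    (ha : m = a + 1) (hb : (2.7182818286 : ℝ) ^ a ≤ b) (hK : b < (K + 1) * a ^ 2) : k ≤ K := by
  subst ha
  have e1 : ((a + 1 : ℕ) : ℝ) - 1 = a := by push_cast; ring
  rw [e1] at hk
  have e2 : Real.exp (a : ℝ) = Real.exp 1 ^ a := by rw [← Real.exp_nat_mul]; simp
  have h1 : Real.exp 1 ^ a ≤ (2.7182818286 : ℝ) ^ a := by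
    gcongr; exact Real.exp_one_lt_d9.le
  have h2 : (k : ℝ) * (a : ℝ) ^ 2 ≤ b := by linarith
  have h3 : k * a ^ 2 ≤ b := by exact_mod_cast h2
  by_contra hc
  push Not at hc
  have : (K + 1) * a ^ 2 ≤ k * a ^ 2 := Nat.mul_le_mul_right _ hc
  omega

end Helpers

theorem stmt7 (m : ℕ) (hm : 3 ≤ m) (S : ℤ) (hS : IsS m S) (k : ℕ) (hk : 0 < k)
    (h : (k : ℤ) * m - nthPrime k = S) :
    (k : ℝ) > Real.exp ((m : ℝ) - 1) / ((m : ℝ) - 1) ^ 2 := by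
  by_contra hcon
  push Not at hcon
  have hm' : (3 : ℝ) ≤ m := by exact_mod_cast hm
  rw [le_div_iff₀ (by nlinarith)] at hcon
  have hSj : ∀ j : ℕ, 0 < j → (j : ℤ) * m - nthPrime j ≤ S := fun j hj => hS.2 ⟨j, hj, rfl⟩
  have hπ := count_le m S hm hSj
  have hpk : 2 * k - 1 ≤ nthPrime k := by
    have := nth_prime_ge (k - 1)
    unfold nthPrime
    omega
  have hSk : S ≤ k * (m - 2 : ℤ) + 1 := by
    have h2 : (2 : ℤ) * k - 1 ≤ nthPrime k := by omega
    rw [← h]; linarith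
  rcases Nat.lt_or_ge m 15 with hlt | hge
  · have h7 := hπ 7 (by norm_num)
    have h31 := hπ 31 (by norm_num)
    have h113 := hπ 113 (by norm_num)
    have h199 := hπ 199 (by norm_num)
    have h12 := hπ (2 + 2 ^ (12 + 1)) (by norm_num)
    have h16 := hπ (2 + 2 ^ (16 + 1)) (by norm_num)
    have g7 := d7
    have g31 := d31
    have g113 := d113
    have g199 := d199
    have g12 := card_lower 12 956 (by norm_num) c12
    have g16 := card_lower 16 12179 (by norm_num) c16
    generalize (Finset.filter Nat.Prime (Finset.Icc 1 7)).card = x7 at *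
    generalize (Finset.filter Nat.Prime (Finset.Icc 1 31)).card = x31 at *
    generalize (Finset.filter Nat.Prime (Finset.Icc 1 113)).card = x113 at *
    generalize (Finset.filter Nat.Prime (Finset.Icc 1 199)).card = x199 at *
    generalize (Finset.filter Nat.Prime (Finset.Icc 1 (2 + 2 ^ (12 + 1)))).card = x12 at *
    generalize (Finset.filter Nat.Prime (Finset.Icc 1 (2 + 2 ^ (16 + 1)))).card = x16 at *
    clear hS hSj hπ h hpk
    norm_num at h7 h31 h113 h199 h12 h16
    obtain rfl | rfl | rfl | rfl | rfl | rfl | rfl | rfl | rfl | rfl | rfl | rfl :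
      m = 3 ∨ m = 4 ∨ m = 5 ∨ m = 6 ∨ m = 7 ∨ m = 8 ∨ m = 9 ∨ m = 10 ∨ m = 11 ∨ m = 12 ∨
        m = 13 ∨ m = 14 := by omega
    · have := k_bound 3 k 2 8 2 (by norm_num) hcon rfl (by norm_num) (by norm_num); omega
    · have := k_bound 4 k 3 21 2 (by norm_num) hcon rfl (by norm_num) (by norm_num); omega
    · have := k_bound 5 k 4 55 3 (by norm_num) hcon rfl (by norm_num) (by norm_num); omega
    · have := k_bound 6 k 5 149 5 (by norm_num) hcon rfl (by norm_num) (by norm_num); omega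
    · have := k_bound 7 k 6 404 11 (by norm_num) hcon rfl (by norm_num) (by norm_num); omega
    · have := k_bound 8 k 7 1097 22 (by norm_num) hcon rfl (by norm_num) (by norm_num); omega
    · have := k_bound 9 k 8 2981 46 (by norm_num) hcon rfl (by norm_num) (by norm_num); omega
    · have := k_bound 10 k 9 8104 100 (by norm_num) hcon rfl (by norm_num) (by norm_num); omega
    · have := k_bound 11 k 10 22027 220 (by norm_num) hcon rfl (by norm_num) (by norm_num); omega
    · have := k_bound 12 k 11 59875 494 (by norm_num) hcon rfl (by norm_num) (by norm_num); omega
    · have := k_bound 13 k 12 162755 1130 (by norm_num) hcon rfl (by norm_num) (by norm_num); omega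
    · have := k_bound 14 k 13 442414 2617 (by norm_num) hcon rfl (by norm_num) (by norm_num); omega
  · have hS0 : 0 ≤ S := by
      have hS1 := hSj 1 one_pos
      have e1 : nthPrime 1 = 2 := Nat.nth_prime_zero_eq_two
      rw [e1] at hS1
      push_cast at hS1
      omega
    refine gen_case m hge (S : ℝ) (by exact_mod_cast hS0) ?_ ?_
    · have h1 : (S : ℝ) ≤ k * ((m : ℝ) - 2) + 1 := by exact_mod_cast hSk
      have hk0 : (0 : ℝ) ≤ k := by positivity
      have h2 : (k : ℝ) * (((m : ℝ) - 2) * m) ≤ k * ((m : ℝ) - 1) ^ 2 := by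
        apply mul_le_mul_of_nonneg_left _ hk0; nlinarith
      have h3 := mul_le_mul_of_nonneg_right h1 (show (0 : ℝ) ≤ m by linarith)
      linarith
    · intro n hn
      exact_mod_cast hπ n hn
end

section
/- For every integer m > 3, there exists a positive integer n such that π(m·n) = F_m + n. -/
/-- Step down: if `π(m n₀) ≥ F + n₀` for some positive `n₀`, the value `F + n` is attained. -/
theorem exists_of_ge (m F n₀ : ℕ) (hm : 0 < m) (hn₀ : 0 < n₀)
    (h : F + n₀ ≤ Nat.primeCounting (m * n₀)) :
    ∃ n : ℕ, 0 < n ∧ Nat.primeCounting (m * n) = F + n := by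
  have hev : ∃ k : ℕ, Nat.primeCounting (m * (n₀ + k)) < F + (n₀ + k) := by
    have h1 := Chebyshev.eventually_primeCounting_le (ε := 1) one_pos
    have h2 := Real.tendsto_log_atTop.eventually_gt_atTop ((Real.log 4 + 1) * m)
    have h3 : Filter.Tendsto (fun k : ℕ => ((m * (n₀ + k) : ℕ) : ℝ)) Filter.atTop Filter.atTop := by
      apply tendsto_natCast_atTop_atTop.comp
      apply Filter.tendsto_atTop_mono (f := fun k : ℕ => k) _ Filter.tendsto_id
      intro k
      nlinarith
    obtain ⟨k, hk1, hk2⟩ := ((h3.eventually h1).and (h3.eventually h2)).exists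
    refine ⟨k, ?_⟩
    rw [Nat.floor_natCast] at hk1
    have hl4 : 0 < Real.log 4 := Real.log_pos (by norm_num)
    have hm' : (0 : ℝ) < m := by exact_mod_cast hm
    have hlog : 0 < Real.log ((m * (n₀ + k) : ℕ) : ℝ) := lt_trans (by positivity) hk2
    have hn : (0 : ℝ) < ((n₀ + k : ℕ) : ℝ) := by exact_mod_cast (by omega : 0 < n₀ + k)
    have : (Nat.primeCounting (m * (n₀ + k)) : ℝ) < ((n₀ + k : ℕ) : ℝ) := by
      refine lt_of_le_of_lt hk1 ?_
      rw [div_lt_iff₀ hlog]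
      have := mul_lt_mul_of_pos_left hk2 hn
      push_cast at this ⊢
      linarith
    have : Nat.primeCounting (m * (n₀ + k)) < n₀ + k := by exact_mod_cast this
    omega
  classical
  have hs := Nat.find_spec hev
  have hmin := fun j => Nat.find_min (H := hev) (m := j)
  revert hs hmin
  generalize Nat.find hev = k
  intro hs hmin
  cases k with
  | zero => simp at hs; omega
  | succ k =>
    refine ⟨n₀ + k, by omega, ?_⟩
    have h1 := hmin k (by omega)
    have h2 : Nat.primeCounting (m * (n₀ + k)) ≤ Nat.primeCounting (m * (n₀ + (k + 1))) :=
      Nat.monotone_primeCounting (Nat.mul_le_mul_left _ (by omega))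
    omega

/-- Chebyshev's factorial quotient divides the least common multiple. -/
theorem chebyshev_dvd (n : ℕ) :
    (30 * n).factorial * n.factorial ∣
      ((15 * n).factorial * (10 * n).factorial * (6 * n).factorial) * Nat.lcmUpto (30 * n) := by
  have f0 := fun k : ℕ => Nat.factorial_ne_zero k
  have l0 := Nat.lcmUpto_ne_zero (30 * n)
  rw [← Nat.factorization_prime_le_iff_dvd (mul_ne_zero (f0 _) (f0 _))
    (mul_ne_zero (mul_ne_zero (mul_ne_zero (f0 _) (f0 _)) (f0 _)) l0)]
  intro p hp
  rw [Nat.factorization_mul (f0 _) (f0 _),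
    Nat.factorization_mul (mul_ne_zero (mul_ne_zero (f0 _) (f0 _)) (f0 _)) l0,
    Nat.factorization_mul (mul_ne_zero (f0 _) (f0 _)) (f0 _),
    Nat.factorization_mul (f0 _) (f0 _)]
  simp only [Finsupp.add_apply]
  have hb : ∀ k, k ≤ 30 * n → Nat.log p k < Nat.log p (30 * n) + 1 := fun k hk =>
    Nat.lt_succ_of_le (Nat.log_mono_right hk)
  rw [Nat.factorization_lcmUpto _ hp,
    Nat.factorization_factorial hp (hb (30 * n) le_rfl),
    Nat.factorization_factorial hp (hb n (by omega)),
    Nat.factorization_factorial hp (hb (15 * n) (by omega)),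
    Nat.factorization_factorial hp (hb (10 * n) (by omega)),
    Nat.factorization_factorial hp (hb (6 * n) (by omega))]
  have hc : ∀ b : ℕ, b = ∑ i ∈ Finset.Ico 1 (b + 1), 1 := by intro b; simp
  generalize Nat.log p (30 * n) = b
  refine le_of_le_of_eq ?_ (congrArg (_ + ·) (hc b).symm)
  simp only [← Finset.sum_add_distrib]
  apply Finset.sum_le_sum
  intro i _
  generalize p ^ i = q
  have e : ∀ a b : ℕ, 0 < b → a * b = 30 → a * n / q = 30 * n / q / b := by
    intro a b hb hab
    rw [Nat.div_div_eq_div_mul, mul_comm q b, ← Nat.div_div_eq_div_mul]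
    congr 1
    rw [← hab, mul_right_comm, Nat.mul_div_cancel _ hb]
  have e15 := e 15 2 (by norm_num) rfl
  have e10 := e 10 3 (by norm_num) rfl
  have e6 := e 6 5 (by norm_num) rfl
  have e1 := e 1 30 (by norm_num) rfl
  rw [one_mul] at e1
  rw [e15, e10, e6, e1]
  omega

theorem log_factorial_le {n : ℕ} (hn : n ≠ 0) :
    Real.log n.factorial ≤ n * Real.log n - n + Real.log n / 2 + 1 := by
  obtain ⟨k, rfl⟩ := Nat.exists_eq_succ_of_ne_zero hn
  have h := Stirling.log_stirlingSeq'_antitone (Nat.zero_le k)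
  simp only [Function.comp_apply] at h
  have h1 : ((Nat.succ k : ℕ) : ℝ) ≠ 0 := by positivity
  rw [Stirling.log_stirlingSeq_formula, Nat.succ_eq_add_one 0, zero_add,
    Stirling.log_stirlingSeq_formula, Real.log_div h1 (Real.exp_ne_zero _), Real.log_exp,
    Real.log_mul two_ne_zero h1] at h
  simp at h
  push_cast at h ⊢
  linarith

theorem le_log_factorial {n : ℕ} (hn : n ≠ 0) :
    n * Real.log n - n + Real.log n / 2 ≤ Real.log n.factorial := by
  have h := Stirling.le_log_factorial_stirling hn
  have : 0 ≤ Real.log (2 * Real.pi) := Real.log_nonneg (by linarith [Real.pi_gt_three])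
  linarith

theorem psi_lower (n : ℕ) (hn : n ≠ 0) :
    27.6 * (n : ℝ) - Real.log ((30 * n : ℕ) : ℝ) / 2 - 3 ≤ Chebyshev.psi ((30 * n : ℕ) : ℝ) := by
  have hd := Nat.le_of_dvd (Nat.mul_pos (by positivity) (Nat.lcmUpto_pos _)) (chebyshev_dvd n)
  have f0 : ∀ k : ℕ, ((k.factorial : ℕ) : ℝ) ≠ 0 := fun k => by positivity
  have l0 : ((Nat.lcmUpto (30 * n) : ℕ) : ℝ) ≠ 0 := by exact_mod_cast Nat.lcmUpto_ne_zero _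
  have hd' : (((30 * n).factorial : ℕ) : ℝ) * (n.factorial : ℕ) ≤
      (((15 * n).factorial : ℕ) * ((10 * n).factorial : ℕ) * ((6 * n).factorial : ℕ) : ℝ) *
        (Nat.lcmUpto (30 * n) : ℕ) := by exact_mod_cast hd
  have hl := Real.log_le_log (by positivity) hd'
  rw [Real.log_mul (f0 _) (f0 _),
    Real.log_mul (mul_ne_zero (mul_ne_zero (f0 _) (f0 _)) (f0 _)) l0,
    Real.log_mul (mul_ne_zero (f0 _) (f0 _)) (f0 _),
    Real.log_mul (f0 _) (f0 _), ← Chebyshev.psi_eq_log_lcmUpto] at hl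
  have a30 := le_log_factorial (n := 30 * n) (by omega)
  have a1 := le_log_factorial (n := n) hn
  have a15 := log_factorial_le (n := 15 * n) (by omega)
  have a10 := log_factorial_le (n := 10 * n) (by omega)
  have a6 := log_factorial_le (n := 6 * n) (by omega)
  have hn' : (n : ℝ) ≠ 0 := by exact_mod_cast hn
  have hpos : (0 : ℝ) < n := by positivity
  have e6 : Real.log 6 = Real.log 2 + Real.log 3 := by
    rw [← Real.log_mul (by norm_num) (by norm_num)]; norm_num
  have e10 : Real.log 10 = Real.log 2 + Real.log 5 := by
    rw [← Real.log_mul (by norm_num) (by norm_num)]; norm_num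
  have e15 : Real.log 15 = Real.log 3 + Real.log 5 := by
    rw [← Real.log_mul (by norm_num) (by norm_num)]; norm_num
  have e30 : Real.log 30 = Real.log 2 + Real.log 3 + Real.log 5 := by
    rw [← e6, ← Real.log_mul (by norm_num) (by norm_num)]; norm_num
  push_cast at a30 a15 a10 a6 hl ⊢
  rw [Real.log_mul (by norm_num) hn'] at a30 a15 a10 a6 ⊢
  rw [e30] at a30 ⊢
  rw [e15] at a15
  rw [e10] at a10
  rw [e6] at a6
  have key : 27.6 * (n : ℝ) ≤ n * (14 * Real.log 2 + 9 * Real.log 3 + 5 * Real.log 5) := by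
    rw [mul_comm]
    apply mul_le_mul_of_nonneg_left _ hpos.le
    linarith [Real.log_two_gt_d9, Real.log_three_gt_d9, Real.log_five_gt_d9]
  linarith

theorem fib_growth (m : ℕ) (hm : 13 ≤ m) :
    30 * (m : ℝ) * ((Nat.fib m : ℝ) / 4 + 1) ≤ (11 / 5 : ℝ) ^ m := by
  have H : ∀ k : ℕ, 30 * ((k + 13 : ℕ) : ℝ) * ((Nat.fib (k + 13) : ℝ) / 4 + 1) ≤
        (11 / 5 : ℝ) ^ (k + 13) ∧
      30 * ((k + 14 : ℕ) : ℝ) * ((Nat.fib (k + 14) : ℝ) / 4 + 1) ≤ (11 / 5 : ℝ) ^ (k + 14) := by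
    intro k
    induction k with
    | zero =>
      have h13 : Nat.fib 13 = 233 := by decide
      have h14 : Nat.fib 14 = 377 := by decide
      simp only [zero_add, h13, h14]
      norm_num
    | succ k ih =>
      obtain ⟨h1, h2⟩ := ih
      refine ⟨by convert h2 using 2, ?_⟩
      have hf : Nat.fib (k + 1 + 14) = Nat.fib (k + 13) + Nat.fib (k + 14) := by
        rw [show k + 1 + 14 = (k + 13) + 2 by ring, Nat.fib_add_two]
      rw [hf]
      have ep : (11 / 5 : ℝ) ^ (k + 1 + 14) = (11 / 5) ^ 2 * (11 / 5) ^ (k + 13) := by ring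
      have ep' : (11 / 5 : ℝ) ^ (k + 14) = (11 / 5) * (11 / 5) ^ (k + 13) := by ring
      rw [ep]
      rw [ep'] at h2
      have hB : (0 : ℝ) < (11 / 5) ^ (k + 13) := by positivity
      generalize (11 / 5 : ℝ) ^ (k + 13) = B at *
      push_cast at *
      have hk : (0 : ℝ) ≤ k := by positivity
      have ha : (0 : ℝ) ≤ (Nat.fib (k + 13) : ℝ) := by positivity
      have hb : (0 : ℝ) ≤ (Nat.fib (k + 14) : ℝ) := by positivity
      generalize (Nat.fib (k + 13) : ℝ) = a at *
      generalize (Nat.fib (k + 14) : ℝ) = b at *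
      generalize (k : ℝ) = x at *
      nlinarith [mul_nonneg hk ha, mul_nonneg hk hb]
  obtain ⟨k, rfl⟩ := Nat.exists_eq_add_of_le hm
  have := (H k).1
  rwa [add_comm k 13] at this

theorem large_case (m : ℕ) (hm : 13 ≤ m) :
    ∃ n : ℕ, 0 < n ∧ Nat.fib m + n ≤ Nat.primeCounting (m * n) := by
  set j := Nat.fib m / 4 + 1 with hj
  have hj1 : (j : ℝ) ≤ (Nat.fib m : ℝ) / 4 + 1 := by
    rw [hj]; push_cast
    have := @Nat.cast_div_le ℝ _ _ _ (Nat.fib m) 4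
    push_cast at this
    linarith
  have hj2 : (Nat.fib m : ℝ) ≤ 4 * j := by
    exact_mod_cast (by omega : Nat.fib m ≤ 4 * j)
  have hj0 : (1 : ℝ) ≤ j := by exact_mod_cast (by omega : 1 ≤ j)
  have hF : (233 : ℝ) ≤ Nat.fib m := by
    have : Nat.fib 13 ≤ Nat.fib m := Nat.fib_mono hm
    have h13 : Nat.fib 13 = 233 := by decide
    rw [h13] at this
    exact_mod_cast this
  have hm' : (13 : ℝ) ≤ m := by exact_mod_cast hm
  have hx : ((30 * (j * m) : ℕ) : ℝ) ≤ (11 / 5 : ℝ) ^ m := by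
    refine le_trans ?_ (fib_growth m hm)
    push_cast
    nlinarith
  have hN0 : j * m ≠ 0 := by
    apply mul_ne_zero <;> omega
  have hx0 : (1 : ℝ) ≤ ((30 * (j * m) : ℕ) : ℝ) := by
    exact_mod_cast (by omega : 1 ≤ 30 * (j * m))
  have hlog : Real.log ((30 * (j * m) : ℕ) : ℝ) ≤ 0.7923 * m := by
    have h1 := Real.log_le_log (by linarith) hx
    rw [Real.log_pow] at h1
    have h2 : Real.log (11 / 5) ≤ 0.7923 := by
      have h3 : Real.log ((11 / 5 : ℝ) ^ 7) ≤ Real.log ((2 : ℝ) ^ 8) :=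
        Real.log_le_log (by norm_num) (by norm_num)
      rw [Real.log_pow, Real.log_pow] at h3
      push_cast at h3
      linarith [Real.log_two_lt_d9]
    nlinarith
  have hlog0 : 0 ≤ Real.log ((30 * (j * m) : ℕ) : ℝ) := Real.log_nonneg hx0
  have hpsi := psi_lower (j * m) hN0
  have hpi := Chebyshev.psi_le_primeCounting_mul_log (30 * (j * m))
  refine ⟨30 * j, by omega, ?_⟩
  rw [show m * (30 * j) = 30 * (j * m) by ring]
  by_contra hlt
  push Not at hlt
  have hlt' : (Nat.primeCounting (30 * (j * m)) : ℝ) ≤ Nat.fib m + 30 * j := by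
    exact_mod_cast hlt.le
  have hA : (Nat.primeCounting (30 * (j * m)) : ℝ) * Real.log ((30 * (j * m) : ℕ) : ℝ) ≤
      (Nat.fib m + 30 * j) * (0.7923 * m) := by
    apply mul_le_mul hlt' hlog hlog0 (by positivity)
  have hjm : ((j * m : ℕ) : ℝ) = j * m := by push_cast; ring
  rw [hjm] at hpsi
  have hB : (27.6 : ℝ) * (j * m) - 0.7923 * m / 2 - 3 ≤ (Nat.fib m + 30 * j) * (0.7923 * m) := by
    linarith
  have hC : (3 : ℝ) < m * (27.6 * j - 0.7923 / 2 - 0.7923 * (Nat.fib m + 30 * j)) := by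
    have : (1 : ℝ) ≤ 27.6 * j - 0.7923 / 2 - 0.7923 * (Nat.fib m + 30 * j) := by linarith
    nlinarith
  linarith

/-- The primes below 53. -/
def smallPrimes : List ℕ := [2, 3, 5, 7, 11, 13, 17, 19, 23, 29, 31, 37, 41, 43, 47]

/-- A primality test that is correct for positive answers below `53 ^ 2`. -/
def ptest (n : ℕ) : Bool :=
  smallPrimes.elem n || (Nat.blt 1 n && Nat.beq (Nat.gcd n 614889782588491410) 1)

/-- Number of `k ≤ n` passing the test. -/
def pcount (n : ℕ) : ℕ :=
  Nat.rec 0 (fun k c => bif ptest (k + 1) then c + 1 else c) n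

theorem ptest_prime (n : ℕ) (hn : n < 2809) (h : ptest n = true) : n.Prime := by
  simp only [ptest, Bool.or_eq_true, Bool.and_eq_true] at h
  rcases h with h | ⟨h1, h2⟩
  · have h : n ∈ smallPrimes := by simpa using h
    simp only [smallPrimes, List.mem_cons, List.not_mem_nil, or_false] at h
    rcases h with h | h | h | h | h | h | h | h | h | h | h | h | h | h | h <;> subst h <;> norm_num
  · have h1 : 1 < n := by simpa [Nat.blt_eq] using h1
    have h2 : Nat.gcd n 614889782588491410 = 1 := by simpa using h2
    by_contra hp
    have hq := Nat.minFac_prime (n := n) (by omega)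
    have hsq := Nat.minFac_sq_le_self (by omega) hp
    have hlt : n.minFac < 53 := by nlinarith
    have hdvd : n.minFac ∣ 614889782588491410 := by
      revert hq hlt
      generalize n.minFac = q
      intro hq hlt
      interval_cases q <;> revert hq <;> norm_num
    have := Nat.dvd_gcd (Nat.minFac_dvd n) hdvd
    rw [h2] at this
    exact hq.one_lt.ne' (Nat.dvd_one.mp this)

theorem pcount_le (n : ℕ) (hn : n < 2809) : pcount n ≤ Nat.primeCounting n := by
  induction n with
  | zero => simp [pcount]
  | succ k ih =>
    have ih := ih (by omega)
    have hs : Nat.primeCounting (k + 1) =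
        Nat.primeCounting k + if (k + 1).Prime then 1 else 0 := by
      simp only [Nat.primeCounting, Nat.primeCounting', Nat.count_succ]
    have hc : pcount (k + 1) = bif ptest (k + 1) then pcount k + 1 else pcount k := rfl
    rw [hs, hc]
    cases ht : ptest (k + 1) with
    | false => simp; omega
    | true => simp [ptest_prime (k + 1) hn ht]; omega

theorem small_case (m n : ℕ) (hn : 0 < n) (hmn : m * n < 2809)
    (h : Nat.ble (Nat.fib m + n) (pcount (m * n)) = true) :
    ∃ n : ℕ, 0 < n ∧ Nat.fib m + n ≤ Nat.primeCounting (m * n) :=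
  ⟨n, hn, (Nat.le_of_ble_eq_true h).trans (pcount_le _ hmn)⟩

theorem exists_ge (m : ℕ) (hm : 3 < m) :
    ∃ n : ℕ, 0 < n ∧ Nat.fib m + n ≤ Nat.primeCounting (m * n) := by
  rcases Nat.lt_or_ge m 13 with h | h
  · interval_cases m
    · exact small_case 4 5 (by norm_num) (by norm_num) (by decide +kernel)
    · exact small_case 5 12 (by norm_num) (by norm_num) (by decide +kernel)
    · exact small_case 6 20 (by norm_num) (by norm_num) (by decide +kernel)
    · exact small_case 7 20 (by norm_num) (by norm_num) (by decide +kernel)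
    · exact small_case 8 35 (by norm_num) (by norm_num) (by decide +kernel)
    · exact small_case 9 80 (by norm_num) (by norm_num) (by decide +kernel)
    · exact small_case 10 100 (by norm_num) (by norm_num) (by decide +kernel)
    · exact small_case 11 140 (by norm_num) (by norm_num) (by decide +kernel)
    · exact small_case 12 200 (by norm_num) (by norm_num) (by decide +kernel)
  · exact large_case m h

theorem stmt11 (m : ℕ) (hm : 3 < m) :
    ∃ n : ℕ, 0 < n ∧ Nat.primeCounting (m * n) = Nat.fib m + n := by
  obtain ⟨n, hn, h⟩ := exists_ge m hm
  exact exists_of_ge m (Nat.fib m) n (by omega) hn h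
end
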